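/- For every finite word u over {a,b,c,d,e} with 2 ≤ |u| ≤ 100, some conjugate of u is not a factor of w₅ = G(F^ω(0)); that is, w₅ contains no complete conjugacy class of length between 2 and 100. -/

import Mathlib

/-- The morphism F on the alphabet Σ = {0,1,2,3,4}. -/
def F : Fin 5 → List (Fin 5)
  | 0 => [0, 1]
  | 1 => [2]
  | 2 => [0, 3]
  | 3 => [2, 4]
  | 4 => [2, 3]

/-- Extension of F to words. -/
def Fw (w : List (Fin 5)) : List (Fin 5) := w.flatMap F

/-- `u` is a factor of the fixed point F^ω(0). -/
def FactorF (u : List (Fin 5)) : Prop := ∃ n, u <:+: Fw^[n] [0]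

/-- `v` is a conjugate (cyclic rotation) of `u`. -/
def Conj (u v : List (Fin 5)) : Prop := ∃ s t, u = s ++ t ∧ v = t ++ s

/-- The morphism G : Σ* → Δ*, where Δ = {a,b,c,d,e} is coded as
`a = 0, b = 1, c = 2, d = 3, e = 4`. -/
def G : Fin 5 → List (Fin 5)
  | 0 => [0, 1, 2, 3]      -- abcd
  | 1 => []                -- ε
  | 2 => [4, 0, 2, 3]      -- eacd
  | 3 => [1, 4, 2, 3]      -- becd
  | 4 => [1, 4]            -- be

/-- Extension of G to words. -/
def Gw (w : List (Fin 5)) : List (Fin 5) := w.flatMap G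

/-- `u` is a factor of w₅ = G(F^ω(0)). -/
def FactorW5 (u : List (Fin 5)) : Prop := ∃ n, u <:+: Gw (Fw^[n] [0])

/-! ### A finite word containing all short factors of `w₅` -/

/-- A word over `Σ` whose two-letter factors are exactly those of `F^ω(0)`. -/
def seedWord : List (Fin 5) := [2, 0, 1, 2, 3, 2, 4, 0, 3, 0]

/-- The image of a letter under `G ∘ F^7`. -/
def block (c : Fin 5) : List (Fin 5) := Gw (Fw^[7] [c])

/-- The word `G(F^7(seedWord))`, which contains every factor of `w₅` of length at most `100`. -/
def coverWord : List (Fin 5) := Gw (Fw^[7] seedWord)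

/-- Two letters that are adjacent somewhere in `seedWord`. -/
def Adjacent (x y : Fin 5) : Prop := [x, y] <:+: seedWord

instance : DecidableRel Adjacent := fun x y => inferInstanceAs (Decidable ([x, y] <:+: seedWord))

theorem Fw_append (u v : List (Fin 5)) : Fw (u ++ v) = Fw u ++ Fw v := List.flatMap_append

theorem Gw_append (u v : List (Fin 5)) : Gw (u ++ v) = Gw u ++ Gw v := List.flatMap_append

theorem iterate_Fw_append (n : ℕ) (u v : List (Fin 5)) :
    Fw^[n] (u ++ v) = Fw^[n] u ++ Fw^[n] v := by
  induction n generalizing u v with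
  | zero => rfl
  | succ n ih => simp [Function.iterate_succ_apply, Fw_append, ih]

theorem Gw_iterate_Fw_seven (w : List (Fin 5)) : Gw (Fw^[7] w) = w.flatMap block := by
  induction w with
  | nil => rfl
  | cons c w ih =>
    rw [← List.singleton_append, iterate_Fw_append, Gw_append, ih, List.flatMap_append,
      List.flatMap_singleton, block]

theorem isChain_Fw {w : List (Fin 5)} (h : w.IsChain Adjacent) : (Fw w).IsChain Adjacent := by
  induction w with
  | nil => exact List.IsChain.nil
  | cons a w ih =>
    have hF : ∀ c, (F c).IsChain Adjacent := by decide
    have hFF : ∀ a b, Adjacent a b →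
        ∀ x ∈ (F a).getLast?, ∀ y ∈ (F b).head?, Adjacent x y := by decide
    have hne : ∀ c, F c ≠ [] := by decide
    change (F a ++ Fw w).IsChain Adjacent
    refine List.isChain_append.2 ⟨hF a, ih h.tail, ?_⟩
    cases w with
    | nil => simp [Fw]
    | cons b w =>
      have : (Fw (b :: w)).head? = (F b).head? := by
        simp [Fw, List.head?_append_of_ne_nil _ (hne b)]
      rw [this]
      exact hFF a b (List.isChain_cons_cons.1 h).1

theorem isChain_iterate_Fw (n : ℕ) : (Fw^[n] [0]).IsChain Adjacent := by
  induction n with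
  | zero => exact List.IsChain.singleton 0
  | succ n ih => rw [Function.iterate_succ_apply']; exact isChain_Fw ih

theorem prefix_iterate_Fw_add (n k : ℕ) : Fw^[n] [0] <+: Fw^[n + k] [0] := by
  obtain ⟨t, ht⟩ : [0] <+: Fw^[k] [0] := by
    induction k with
    | zero => exact List.prefix_rfl
    | succ k ih =>
      obtain ⟨t, ht⟩ := ih
      rw [Function.iterate_succ_apply', ← ht, Fw_append]
      exact ⟨1 :: Fw t, rfl⟩
  rw [Function.iterate_add_apply, ← ht, iterate_Fw_append]
  exact List.prefix_append _ _

/-- A short factor of a concatenation of long blocks lies within two consecutive blocks. -/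
theorem infix_of_infix_flatMap {α β : Type*} {R : α → α → Prop} {H : α → List β} {W v : List β}
    (hW : ∀ x y, R x y → H x ++ H y <:+: W) (hH : ∀ x, H x <:+: W)
    (hv : ∀ x, v.length ≤ (H x).length) {w : List α} (hw : w.IsChain R)
    (h : v <:+: w.flatMap H) : v <:+: W := by
  induction w with
  | nil =>
    obtain rfl : v = [] := by simpa using h
    exact List.nil_infix
  | cons a w ih =>
    rw [List.flatMap_cons, List.infix_append_iff] at h
    rcases h with h | h | ⟨s, p, rfl, hs, hp⟩
    · exact h.trans (hH a)
    · exact ih hw.tail h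
    · cases w with
      | nil =>
        obtain rfl : p = [] := by simpa using hp
        simpa using hs.isInfix.trans (hH a)
      | cons b w =>
        have hp' : p <+: H b := by
          refine List.prefix_of_prefix_length_le hp ?_ ?_ (l₃ := (b :: w).flatMap H)
          · simp
          · have := hv b
            simp only [List.length_append] at this
            omega
        obtain ⟨s', hs'⟩ := hs
        obtain ⟨p', hp'⟩ := hp'
        refine List.IsInfix.trans ⟨s', p', ?_⟩ (hW a b (List.isChain_cons_cons.1 hw).1)
        rw [← hs', ← hp']
        simp

theorem infix_coverWord {v : List (Fin 5)} (hv : v.length ≤ 100) (h : FactorW5 v) :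
    v <:+: coverWord := by
  obtain ⟨n, hn⟩ := h
  have hpre : Gw (Fw^[n] [0]) <+: Gw (Fw^[7] (Fw^[n] [0])) := by
    rw [← Function.iterate_add_apply, add_comm]
    obtain ⟨t, ht⟩ := prefix_iterate_Fw_add n 7
    rw [← ht, Gw_append]
    exact List.prefix_append _ _
  have hcover : ∀ {x : List (Fin 5)}, x <:+: seedWord → x.flatMap block <:+: coverWord := by
    rintro x ⟨s, t, hst⟩
    refine ⟨s.flatMap block, t.flatMap block, ?_⟩
    rw [coverWord, Gw_iterate_Fw_seven, ← hst]
    simp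
  have hlen : ∀ c, 100 ≤ (block c).length := by decide +kernel
  have hmem : ∀ c, [c] <:+: seedWord := by decide
  rw [Gw_iterate_Fw_seven] at hpre
  refine infix_of_infix_flatMap (R := Adjacent) (fun x y hxy => ?_) (fun x => ?_)
    (fun x => hv.trans (hlen x)) (isChain_iterate_Fw n) (hn.trans hpre.isInfix)
  · simpa using hcover hxy
  · simpa using hcover (hmem x)

/-! ### Sets of positions as bit masks -/

/-- The bit mask of the positions at which the letter `c` occurs in `w`. -/
def positions (c : Fin 5) : List (Fin 5) → ℕ
  | [] => 0
  | x :: w => Nat.bit (x == c) (positions c w)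

theorem testBit_positions (c : Fin 5) (w : List (Fin 5)) (i : ℕ) :
    (positions c w).testBit i = true ↔ w[i]? = some c := by
  induction w generalizing i with
  | nil => simp [positions]
  | cons x w ih =>
    cases i with
    | zero => simp [positions]
    | succ i => simp [positions, Nat.testBit_bit_succ, ih]

/-- `force n f = f n`, arranged so that the kernel evaluates `n` before passing it on. -/
def force {α : Type*} (n : ℕ) (f : ℕ → α) : α :=
  match n with
  | 0 => f 0
  | .succ k => f (.succ k)

theorem force_eq {α : Type*} (n : ℕ) (f : ℕ → α) : force n f = f n := by
  cases n <;> rfl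

/-- The position of the highest bit of `S`, provided that it lies in `[i, i + 2 ^ k)`. -/
def highBit (S : ℕ) : (k i : ℕ) → ℕ
  | 0, i => i
  | k + 1, i =>
    force (i + 2 ^ k) fun j => bif (S >>> j) == 0 then highBit S k i else highBit S k j

section BitMasks

variable (b₀ b₁ b₂ b₃ b₄ : ℕ)

/-- The first of the given masks containing the position `p`. -/
def maskAt (p : ℕ) : ℕ :=
  bif b₀.testBit p then b₀ else bif b₁.testBit p then b₁ else
    bif b₂.testBit p then b₂ else bif b₃.testBit p then b₃ else b₄

/-- Reads the rotation by `s` of the length-`n` word at position `i`, letter by letter. The mask `z`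
holds the occurrences of the part read so far, and `m` the positions of words whose rotation by `s`
begins with that part. Once the part read no longer occurs, `m` is returned. -/
def deadBy (n s i : ℕ) : (fuel z m : ℕ) → ℕ
  | 0, z, m => bif z == 0 then m else 0
  | fuel + 1, z, m =>
    bif z == 0 then m else
      force ((n - (fuel + 1) + s) % n) fun p =>
        force (maskAt b₀ b₁ b₂ b₃ b₄ (i + p)) fun b =>
          force (z &&& (b >>> (n - (fuel + 1)))) fun z =>
            deadBy n s i fuel z (m &&& (b >>> p))

/-- Searches for a rotation by at most `s` excluding the length-`n` word at position `i`. -/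
def dead (n i S full : ℕ) : (s : ℕ) → ℕ
  | 0 => 0
  | s + 1 =>
    force (deadBy b₀ b₁ b₂ b₃ b₄ n (s + 1) i n full S) fun m =>
      bif m == 0 then dead n i S full s else m

/-- Excludes, one batch after the other, all length-`n` words at positions in `A`. The mask `D`
collects the positions of words excluded so far. -/
def allDead (n full A : ℕ) : (fuel D : ℕ) → Bool
  | 0, _ => false
  | fuel + 1, D =>
    force (A - (A &&& D)) fun S =>
      bif S == 0 then true else
        force (highBit S 12 0) fun i =>
          force (dead b₀ b₁ b₂ b₃ b₄ n i S full (n - 1)) fun m =>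
            bif m == 0 then false else force (D ||| m) fun D => allDead n full A fuel D

end BitMasks

/-- The positions at which rotations of words of length `n` are anchored: the occurrences of `ec`
if `n ≥ 27`, and all positions otherwise, as long as a word of length `n` fits there. -/
def anchors (full b₂ b₄ n : ℕ) : ℕ :=
  (full >>> (n - 1)) &&& (bif Nat.ble 27 n then b₄ &&& (b₂ >>> 1) else full)

/-- The positions from which a position in `S` is reached in fewer than `k` steps. -/
def reach (S : ℕ) : (k : ℕ) → ℕ
  | 0 => 0
  | k + 1 => reach S k ||| (S >>> k)

/-- The verification that all words of length between `2` and `100` are excluded. -/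
def certificate : Bool :=
  force (positions 0 coverWord) fun b₀ => force (positions 1 coverWord) fun b₁ =>
  force (positions 2 coverWord) fun b₂ => force (positions 3 coverWord) fun b₃ =>
  force (positions 4 coverWord) fun b₄ => force (2 ^ 2312 - 1) fun full =>
  (List.range 99).all fun k =>
    force (k + 2) fun n => force (anchors full b₂ b₄ n) fun A =>
      allDead b₀ b₁ b₂ b₃ b₄ n full A 1000 0

theorem certificate_eq_true : certificate = true := by decide +kernel

theorem length_coverWord : coverWord.length = 2312 := by decide +kernel

theorem reach_anchors :
    reach (positions 4 coverWord &&& (positions 2 coverWord >>> 1)) 26 &&& (2 ^ 2286 - 1) =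
      2 ^ 2286 - 1 := by
  decide +kernel

/-! ### Soundness of the search -/

/-- Every rotation of the length-`n` word at position `j` of `coverWord` occurs in `coverWord`. -/
def RotationsOccur (n j : ℕ) : Prop :=
  ∀ s < n, ∃ j' < 2312, ∀ k < n, coverWord[j' + k]? = coverWord[j + (k + s) % n]?

theorem exists_maskAt_eq {w : List (Fin 5)} (p : ℕ) :
    ∃ c, maskAt (positions 0 w) (positions 1 w) (positions 2 w) (positions 3 w) (positions 4 w) p =
      positions c w := by
  simp only [maskAt, cond_eq_ite]
  split_ifs <;> exact ⟨_, rfl⟩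

theorem testBit_deadBy {w : List (Fin 5)} {n s i j j' fuel z m : ℕ} (hfuel : fuel ≤ n)
    (hrot : ∀ k < n, w[j' + k]? = w[j + (k + s) % n]?)
    (h : m.testBit j = true → z.testBit j' = true) :
    (deadBy (positions 0 w) (positions 1 w) (positions 2 w) (positions 3 w) (positions 4 w)
      n s i fuel z m).testBit j = false := by
  induction fuel generalizing z m with
  | zero =>
    by_cases hz : z = 0
    · simpa [deadBy, hz] using h
    · simp [deadBy, beq_eq_false_iff_ne.2 hz]
  | succ fuel ih =>
    by_cases hz : z = 0
    · simpa [deadBy, hz] using h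
    · obtain ⟨c, hc⟩ := exists_maskAt_eq (w := w) (i + (n - (fuel + 1) + s) % n)
      simp only [deadBy, force_eq, hc, beq_eq_false_iff_ne.2 hz, cond_false]
      refine ih (by omega) ?_
      simp only [Nat.testBit_and, Nat.testBit_shiftRight, Bool.and_eq_true, testBit_positions]
      rintro ⟨hm, hp⟩
      refine ⟨h hm, ?_⟩
      rw [add_comm, hrot _ (by omega), add_comm j, hp]

theorem testBit_full {i : ℕ} (hi : i < 2312) : (2 ^ 2312 - 1).testBit i = true := by
  rw [Nat.testBit_two_pow_sub_one, decide_eq_true hi]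

theorem testBit_dead {n i j S t : ℕ} (hj : RotationsOccur n j) (ht : t < n) :
    (dead (positions 0 coverWord) (positions 1 coverWord) (positions 2 coverWord)
      (positions 3 coverWord) (positions 4 coverWord) n i S (2 ^ 2312 - 1) t).testBit j =
      false := by
  induction t with
  | zero => simp [dead]
  | succ t ih =>
    obtain ⟨j', hj', hrot⟩ := hj (t + 1) ht
    simp only [dead, force_eq, cond_eq_ite]
    split_ifs
    · exact ih (by omega)
    · exact testBit_deadBy le_rfl hrot fun _ => testBit_full hj'

theorem testBit_of_allDead {n j A fuel D : ℕ} (hn : 0 < n) (hj : RotationsOccur n j)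
    (hD : D.testBit j = false)
    (h : allDead (positions 0 coverWord) (positions 1 coverWord) (positions 2 coverWord)
      (positions 3 coverWord) (positions 4 coverWord) n (2 ^ 2312 - 1) A fuel D = true) :
    A.testBit j = false := by
  induction fuel generalizing D with
  | zero => simp [allDead] at h
  | succ fuel ih =>
    simp only [allDead, force_eq, cond_eq_ite] at h
    split_ifs at h with hS hm
    · have hA : A &&& D = A :=
        le_antisymm Nat.and_le_left (Nat.sub_eq_zero_iff_le.1 (beq_iff_eq.1 hS))
      rw [← hA, Nat.testBit_and, hD, Bool.and_false]
    · refine ih ?_ h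
      rw [Nat.testBit_or, hD, Bool.false_or]
      exact testBit_dead hj (by omega)

theorem exists_testBit_of_testBit_reach {S k j : ℕ} (h : (reach S k).testBit j = true) :
    ∃ t < k, S.testBit (j + t) = true := by
  induction k with
  | zero => simp [reach] at h
  | succ k ih =>
    simp only [reach, Nat.testBit_or, Nat.testBit_shiftRight, Bool.or_eq_true] at h
    rcases h with h | h
    · obtain ⟨t, ht, hS⟩ := ih h
      exact ⟨t, by omega, hS⟩
    · exact ⟨k, by omega, by rwa [add_comm]⟩

theorem testBit_anchors_eq_false {n j : ℕ} (hn : 2 ≤ n) (hn' : n ≤ 100)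
    (hj : RotationsOccur n j) :
    (anchors (2 ^ 2312 - 1) (positions 2 coverWord) (positions 4 coverWord) n).testBit j =
      false := by
  have h := certificate_eq_true
  simp only [certificate, force_eq, List.all_eq_true, List.mem_range] at h
  have h := h (n - 2) (by omega)
  rw [Nat.sub_add_cancel hn] at h
  exact testBit_of_allDead (by omega) hj (by simp) h

theorem exists_ec_lt {j : ℕ} (hj : j < 2286) :
    ∃ t < 26, coverWord[j + t]? = some 4 ∧ coverWord[j + t + 1]? = some 2 := by
  have h := congrArg (Nat.testBit · j) reach_anchors
  simp only [Nat.testBit_and, Nat.testBit_two_pow_sub_one, hj, decide_true, Bool.and_true] at h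
  obtain ⟨t, ht, hS⟩ := exists_testBit_of_testBit_reach h
  simp only [Nat.testBit_and, Nat.testBit_shiftRight, Bool.and_eq_true, testBit_positions] at hS
  exact ⟨t, ht, hS.1, by rw [add_comm]; exact hS.2⟩

theorem exists_position {u v : List (Fin 5)} {s : ℕ}
    (hv : v = u.rotate s) (h : v <:+: coverWord) :
    ∃ j, j + u.length ≤ 2312 ∧
      ∀ k < u.length, coverWord[j + k]? = u[(k + s) % u.length]? := by
  obtain ⟨p, q, hpq⟩ := h
  have hlen : v.length = u.length := by rw [hv, List.length_rotate]
  refine ⟨p.length, ?_, fun k hk => ?_⟩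
  · rw [← length_coverWord, ← hpq]
    simp [hlen]
  · rw [← hpq, List.append_assoc, List.getElem?_append_right (by omega), Nat.add_sub_cancel_left,
      List.getElem?_append_left (by omega), hv, List.getElem?_rotate hk]

theorem no_short_conjugacy_class_in_w5 :
    ∀ u : List (Fin 5), 2 ≤ u.length → u.length ≤ 100 →
      ∃ v, Conj u v ∧ ¬ FactorW5 v := by
  intro u hu hu'
  by_contra! hall
  set n := u.length with hn
  have hpos : ∀ s < n, ∃ j, j + n ≤ 2312 ∧ ∀ k < n, coverWord[j + k]? = u[(k + s) % n]? := by
    intro s hs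
    refine exists_position rfl (infix_coverWord (by simpa using hu') (hall _ ?_))
    exact ⟨u.take s, u.drop s, (List.take_append_drop s u).symm,
      List.rotate_eq_drop_append_take hs.le⟩
  have hocc : ∀ t < n, ∀ j, (∀ k < n, coverWord[j + k]? = u[(k + t) % n]?) →
      RotationsOccur n j := by
    intro t ht j hj s hs
    obtain ⟨j', hj', h⟩ := hpos ((s + t) % n) (Nat.mod_lt _ (by omega))
    refine ⟨j', by omega, fun k hk => ?_⟩
    rw [h k hk, hj _ (Nat.mod_lt _ (by omega)), Nat.mod_add_mod, Nat.add_mod_mod, add_assoc]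
  have hfit : ∀ {j}, j + n ≤ 2312 → n - 1 + j < 2312 := fun h => by omega
  obtain ⟨j₀, hj₀, h₀⟩ := hpos 0 (by omega)
  by_cases h27 : 27 ≤ n
  · obtain ⟨t, ht, h4, h2⟩ := exists_ec_lt (j := j₀) (by omega)
    obtain ⟨j, hj, h⟩ := hpos t (by omega)
    have := testBit_anchors_eq_false hu hu' (hocc t (by omega) j h)
    rw [h₀ t (by omega), Nat.add_zero, ← Nat.zero_add t, ← h 0 (by omega)] at h4
    rw [add_assoc, h₀ (t + 1) (by omega), Nat.add_zero, add_comm t, ← h 1 (by omega)] at h2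
    have h2' : coverWord[1 + j]? = some 2 := by rwa [add_comm]
    rw [anchors, Nat.ble_eq_true_of_le h27, cond_true, Nat.testBit_and, Nat.testBit_shiftRight,
      testBit_full (hfit hj), Nat.testBit_and, Nat.testBit_shiftRight, (testBit_positions 4 _ j).2 h4,
      (testBit_positions 2 _ _).2 h2'] at this
    exact absurd this (by decide)
  · have := testBit_anchors_eq_false hu hu' (hocc 0 (by omega) j₀ h₀)
    have hble : Nat.ble 27 n = false := by
      rw [← Bool.not_eq_true, Nat.ble_eq]; exact h27
    rw [anchors, hble, cond_false, Nat.testBit_and, Nat.testBit_shiftRight,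
      testBit_full (hfit hj₀), testBit_full (by omega)] at this
    exact absurd this (by decide)
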